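/- arXiv:1907.02929 — 2 statements merged into one kernel-verified Lean document; each statement's English description precedes it below -/
import Mathlib

section
/- Let π be a node map between two graphs such that (none, none) ∉ π, and let (f, σ) be a swap of π of size K ≥ 2. Then the swapped node map π' := SWAP(π, f, σ) satisfies S(π') ≥ S(π), i.e., it contains at least as many node substitutions as π. -/
/-- A node map between two graphs with node sets `VG` and `VH`: a finite set of
assignments (pairs of optional nodes, `none` modelling the dummy symbol ε) such that
every node of `G` occurs as the first component of exactly one assignment, and every
node of `H` occurs as the second component of exactly one assignment. -/
def IsNodeMap {VG VH : Type*} (π : Finset (Option VG × Option VH)) : Prop :=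
  (∀ u : VG, ∃! w : Option VH, (some u, w) ∈ π) ∧
    (∀ v : VH, ∃! w : Option VG, (w, some v) ∈ π)

/-- A swap of size `K` of the node map `π`: an injective map `f` from a `K`-element
index type `S` into `π`, together with a permutation `σ` of `S` that is a single
`K`-cycle (its support is all of `S`). -/
def IsSwap {VG VH S : Type*} [Fintype S] [DecidableEq S]
    (π : Finset (Option VG × Option VH)) (f : S → Option VG × Option VH)
    (σ : Equiv.Perm S) (K : ℕ) : Prop :=
  Function.Injective f ∧ (∀ i : S, f i ∈ π) ∧ Fintype.card S = K ∧ 2 ≤ K ∧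
    σ.IsCycle ∧ σ.support = Finset.univ

/-- The node map obtained from `π` by carrying out the swap `(f, σ)`: remove the
forward assignments `F = f '' S` and add the backward assignments
`β i = ((f (σ i)).1, (f i).2)`, except for the dummy assignment `(none, none)`. -/
def SWAP {VG VH S : Type*} [DecidableEq VG] [DecidableEq VH] [Fintype S] [DecidableEq S]
    (π : Finset (Option VG × Option VH)) (f : S → Option VG × Option VH)
    (σ : Equiv.Perm S) : Finset (Option VG × Option VH) :=
  (π \ Finset.univ.image f) ∪
    (Finset.univ.filter fun i : S =>
        ((f (σ i)).1, (f i).2) ≠ ((none : Option VG), (none : Option VH))).image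
      (fun i : S => ((f (σ i)).1, (f i).2))

/-- The number of node substitutions contained in a node map. -/
def numSub {VG VH : Type*} [DecidableEq VG] [DecidableEq VH]
    (π : Finset (Option VG × Option VH)) : ℕ :=
  (π.filter fun p => p.1 ≠ none ∧ p.2 ≠ none).card

theorem IsNodeMap.eq_of_snd_eq {VG VH : Type*} {π : Finset (Option VG × Option VH)}
    (hπ : IsNodeMap π) {p q : Option VG × Option VH} (hp : p ∈ π) (hq : q ∈ π)
    (hne : p.2 ≠ none) (h : p.2 = q.2) : p = q := by
  obtain ⟨v, hv⟩ := Option.ne_none_iff_exists'.1 hne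
  refine Prod.ext ((hπ.2 v).unique ?_ ?_) h
  · rwa [← hv]
  · rwa [← hv, h]

/-- If `p` and `q` cover the index type, precomposing `p` with a permutation cannot
decrease the number of indices at which both hold. -/
theorem card_filter_and_le_card_filter_perm_and {S : Type*} [Fintype S]
    (σ : Equiv.Perm S) (p q : S → Prop) [DecidablePred p] [DecidablePred q]
    (h : ∀ i, p i ∨ q i) :
    (Finset.univ.filter fun i => p i ∧ q i).card ≤
      (Finset.univ.filter fun i => p (σ i) ∧ q i).card := by
  classical
  have key (r : S → Prop) [DecidablePred r] :=
    Finset.card_union_add_card_inter (Finset.univ.filter r) (Finset.univ.filter q)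
  have hp := key p
  have hpσ := key fun i => p (σ i)
  have hσ : (Finset.univ.filter fun i => p (σ i)).card = (Finset.univ.filter p).card :=
    Finset.card_equiv σ (by simp)
  have hcover : Finset.univ.filter p ∪ Finset.univ.filter q = Finset.univ := by
    ext i
    simpa using h i
  have hle := Finset.card_le_univ
    ((Finset.univ.filter fun i => p (σ i)) ∪ Finset.univ.filter q)
  rw [hcover, Finset.card_univ] at hp
  rw [Finset.filter_and, Finset.filter_and]
  omega

/-- If `π` is a node map not containing the dummy assignment
`(none, none)` and `(f, σ)` is a swap of `π` of size `K ≥ 2`, then the swapped node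
map `SWAP π f σ` contains at least as many node substitutions as `π`. -/
theorem numSub_swap_ge {VG VH S : Type*} [Fintype VG] [Fintype VH]
    [DecidableEq VG] [DecidableEq VH] [Fintype S] [DecidableEq S] (K : ℕ)
    (π : Finset (Option VG × Option VH)) (hπ : IsNodeMap π)
    (hdummy : ((none : Option VG), (none : Option VH)) ∉ π)
    (f : S → Option VG × Option VH) (σ : Equiv.Perm S)
    (hswap : IsSwap π f σ K) :
    numSub π ≤ numSub (SWAP π f σ) := by
  obtain ⟨hinj, hmem, -⟩ := hswap
  let β : S → Option VG × Option VH := fun i => ((f (σ i)).1, (f i).2)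
  let T := Finset.univ.filter fun i => (f (σ i)).1 ≠ none ∧ (f i).2 ≠ none
  let R := (π \ Finset.univ.image f).filter fun p => p.1 ≠ none ∧ p.2 ≠ none
  have hforward : numSub π ≤
      R.card + (Finset.univ.filter fun i => (f i).1 ≠ none ∧ (f i).2 ≠ none).card := by
    rw [numSub, ← Finset.card_image_of_injective _ hinj]
    refine (Finset.card_le_card fun p hp => ?_).trans (Finset.card_union_le _ _)
    simp only [R, Finset.mem_filter, Finset.mem_union, Finset.mem_sdiff, Finset.mem_image,
      Finset.mem_univ, true_and] at hp ⊢
    by_cases hpf : ∃ i, f i = p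
    · obtain ⟨i, rfl⟩ := hpf
      exact Or.inr ⟨i, hp.2, rfl⟩
    · exact Or.inl ⟨⟨hp.1, hpf⟩, hp.2⟩
  have hβ : Set.InjOn β T := fun i hi j _ hij =>
    hinj (hπ.eq_of_snd_eq (hmem i) (hmem j) (Finset.mem_filter.1 hi).2.2
      (show (β i).2 = (β j).2 from congrArg Prod.snd hij))
  have hdisj : Disjoint R (T.image β) := by
    refine Finset.disjoint_left.2 fun p hp hpT => ?_
    obtain ⟨i, -, rfl⟩ := Finset.mem_image.1 hpT
    obtain ⟨hiR, -, hi⟩ := Finset.mem_filter.1 hp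
    obtain ⟨hiπ, hif⟩ := Finset.mem_sdiff.1 hiR
    exact hif (Finset.mem_image.2
      ⟨i, Finset.mem_univ i, (hπ.eq_of_snd_eq hiπ (hmem i) hi rfl).symm⟩)
  have hsub : R ∪ T.image β ⊆ (SWAP π f σ).filter fun p => p.1 ≠ none ∧ p.2 ≠ none := by
    refine Finset.union_subset (Finset.filter_subset_filter _ Finset.subset_union_left) ?_
    refine Finset.image_subset_iff.2 fun i hi => ?_
    have hi := (Finset.mem_filter.1 hi).2
    refine Finset.mem_filter.2 ⟨Finset.mem_union_right _ (Finset.mem_image_of_mem _ ?_), hi⟩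
    exact Finset.mem_filter.2 ⟨Finset.mem_univ i, fun h => hi.2 (congrArg Prod.snd h)⟩
  have hbackward := Finset.card_le_card hsub
  rw [Finset.card_union_of_disjoint hdisj, Finset.card_image_of_injOn hβ] at hbackward
  have hcover (i : S) : (f i).1 ≠ none ∨ (f i).2 ≠ none := by
    by_contra! h
    have hi : f i = (none, none) := Prod.ext h.1 h.2
    exact hdummy (hi ▸ hmem i)
  have hcount := card_filter_and_le_card_filter_perm_and σ (fun i => (f i).1 ≠ none)
    (fun i => (f i).2 ≠ none) hcover
  exact hforward.trans ((Nat.add_le_add_left hcount _).trans hbackward)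
end

section
/- Let π be a node map between two graphs and let (f, σ) be a swap of π of size K ≥ 2. Then SWAP(π, f, σ) is again a node map: every u : V_G occurs as the first component of exactly one element of SWAP(π, f, σ), and every v : V_H occurs as the second component of exactly one element of SWAP(π, f, σ). -/
theorem mem_SWAP {VG VH S : Type*} [DecidableEq VG] [DecidableEq VH] [Fintype S]
    [DecidableEq S] {π : Finset (Option VG × Option VH)} {f : S → Option VG × Option VH}
    {σ : Equiv.Perm S} {p : Option VG × Option VH} :
    p ∈ SWAP π f σ ↔
      (p ∈ π ∧ ∀ i, f i ≠ p) ∨ p ≠ (none, none) ∧ ∃ i, ((f (σ i)).1, (f i).2) = p := by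
  simp only [SWAP, Finset.mem_union, Finset.mem_sdiff, Finset.mem_image, Finset.mem_filter,
    Finset.mem_univ, true_and, not_exists]
  refine or_congr Iff.rfl ⟨?_, ?_⟩
  · rintro ⟨i, hi, rfl⟩
    exact ⟨hi, i, rfl⟩
  · rintro ⟨hp, i, rfl⟩
    exact ⟨i, hp, rfl⟩

/-- If `π` is a node map and `(f, σ)` is a swap of `π` of size
`K ≥ 2`, then `SWAP π f σ` is again a node map: every node of `G` occurs as the first
component of exactly one of its assignments, and every node of `H` occurs as the
second component of exactly one of its assignments. -/
theorem isNodeMap_swap {VG VH S : Type*} [Fintype VG] [Fintype VH]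
    [DecidableEq VG] [DecidableEq VH] [Fintype S] [DecidableEq S] (K : ℕ)
    (π : Finset (Option VG × Option VH)) (hπ : IsNodeMap π)
    (f : S → Option VG × Option VH) (σ : Equiv.Perm S)
    (hswap : IsSwap π f σ K) :
    IsNodeMap (SWAP π f σ) := by
  obtain ⟨hinj, hmem, -⟩ := hswap
  refine ⟨fun u => ?_, fun v => ?_⟩
  · obtain ⟨w, hw, huniq⟩ := hπ.1 u
    have key : ∀ i, (f i).1 = some u → f i = (some u, w) := fun i hi =>
      Prod.ext hi (huniq _ (hi ▸ hmem i))
    by_cases h : ∃ j, f j = (some u, w)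
    · obtain ⟨j, hj⟩ := h
      refine ⟨(f (σ.symm j)).2, mem_SWAP.2 (.inr ⟨by simp, σ.symm j, by simp [hj]⟩), ?_⟩
      intro w' hw'
      rcases mem_SWAP.1 hw' with ⟨hold, hne⟩ | ⟨-, i, hi⟩
      · exact absurd (huniq w' hold ▸ hj) (hne j)
      · obtain ⟨h1, rfl⟩ := Prod.mk.inj hi
        have hij : σ i = j := hinj ((key _ h1).trans hj.symm)
        simp [← hij]
    · push Not at h
      refine ⟨w, mem_SWAP.2 (.inl ⟨hw, h⟩), fun w' hw' => ?_⟩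
      rcases mem_SWAP.1 hw' with ⟨hold, -⟩ | ⟨-, i, hi⟩
      · exact huniq w' hold
      · exact absurd (key _ (Prod.mk.inj hi).1) (h _)
  · obtain ⟨w, hw, huniq⟩ := hπ.2 v
    have key : ∀ i, (f i).2 = some v → f i = (w, some v) := fun i hi =>
      Prod.ext (huniq _ (hi ▸ hmem i)) hi
    by_cases h : ∃ j, f j = (w, some v)
    · obtain ⟨j, hj⟩ := h
      refine ⟨(f (σ j)).1, mem_SWAP.2 (.inr ⟨by simp, j, by simp [hj]⟩), ?_⟩
      intro w' hw'
      rcases mem_SWAP.1 hw' with ⟨hold, hne⟩ | ⟨-, i, hi⟩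
      · exact absurd (huniq w' hold ▸ hj) (hne j)
      · obtain ⟨rfl, h2⟩ := Prod.mk.inj hi
        have hij : i = j := hinj ((key _ h2).trans hj.symm)
        rw [hij]
    · push Not at h
      refine ⟨w, mem_SWAP.2 (.inl ⟨hw, h⟩), fun w' hw' => ?_⟩
      rcases mem_SWAP.1 hw' with ⟨hold, -⟩ | ⟨-, i, hi⟩
      · exact huniq w' hold
      · exact absurd (key _ (Prod.mk.inj hi).2) (h _)
end
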